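/- Let u ∈ S_n with maximal descent d, and let 1 ≤ i < d < j ≤ n be such that u ⋖ u·t_{ij}. Let v = s_i and w = u·t_{ij}, and take bit scaling with respect to k = d. Then c^w_{u,v} = 1 and c^{N⊗w}_{N⊗u, N⊗v} = 0 for all N > 1. In particular, the saturation property for Schubert coefficients under bit scaling fails. -/

import Mathlib

open scoped Classical

/-- `w` lies in (the copy of) `S_n`: it fixes every point `m ≥ n` (0-indexed). -/
def InSymm (n : ℕ) (w : Equiv.Perm ℕ) : Prop := ∀ m, n ≤ m → w m = m

/-- `w ∈ S_∞`: `w` fixes all but finitely many points. -/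
def IsFinPerm (w : Equiv.Perm ℕ) : Prop := ∃ n, InSymm n w

/-- `ℓ(w)`: the number of inversions of `w`. -/
noncomputable def invLen (w : Equiv.Perm ℕ) : ℕ :=
  Set.ncard {p : ℕ × ℕ | p.1 < p.2 ∧ w p.2 < w p.1}

/-- the Lehmer code of `w` (0-indexed): `lCode w i = #{j > i | w j < w i}`. -/
noncomputable def lCode (w : Equiv.Perm ℕ) (i : ℕ) : ℕ :=
  Set.ncard {j | i < j ∧ w j < w i}

/-- the descent set of `w` (0-indexed). -/
def des (w : Equiv.Perm ℕ) : Set ℕ := {i | w (i + 1) < w i}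

/-- the divided difference operator `∂ᵢ f = (f - sᵢ·f)/(xᵢ - xᵢ₊₁)`. -/
noncomputable def divDiff (i : ℕ) (f : MvPolynomial ℕ ℤ) : MvPolynomial ℕ ℤ :=
  if h : ∃ g, f - MvPolynomial.rename (Equiv.swap i (i + 1)) f =
      (MvPolynomial.X i - MvPolynomial.X (i + 1)) * g
  then h.choose else 0

/-- `𝔖_{w₀} = x₁^{n-1} x₂^{n-2} ⋯ x_{n-1}` (with variables 0-indexed). -/
noncomputable def staircase (n : ℕ) : MvPolynomial ℕ ℤ :=
  ∏ i ∈ Finset.range n, (MvPolynomial.X i : MvPolynomial ℕ ℤ) ^ (n - 1 - i)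

/-- Fuelled recursion computing Schubert polynomials inside `S_n`:
`𝔖_w = ∂ᵢ 𝔖_{w·sᵢ}` whenever `w i < w (i+1)`, starting from `𝔖_{w₀} = staircase n`. -/
noncomputable def SchubertAux (n : ℕ) : ℕ → Equiv.Perm ℕ → MvPolynomial ℕ ℤ
  | 0, _ => staircase n
  | (k + 1), w =>
    if h : ∃ i, i + 1 < n ∧ w i < w (i + 1) then
      divDiff h.choose (SchubertAux n k (w * Equiv.swap h.choose (h.choose + 1)))
    else staircase n

/-- the Schubert polynomial `𝔖_w` of `w ∈ S_∞`. -/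
noncomputable def Schubert (w : Equiv.Perm ℕ) : MvPolynomial ℕ ℤ :=
  if h : IsFinPerm w then SchubertAux h.choose (h.choose * h.choose) w else 0

/-- `c` is the family of Schubert coefficients `c^w_{u,v}` for the pair `(u,v)`, i.e. the
(finitely supported, `S_∞`-supported) coefficients with
`𝔖_u · 𝔖_v = Σ_{w ∈ S_∞} c^w_{u,v} 𝔖_w`. -/
def IsSchubertCoeff (u v : Equiv.Perm ℕ) (c : Equiv.Perm ℕ →₀ ℕ) : Prop :=
  (∀ w ∈ c.support, IsFinPerm w) ∧
  Schubert u * Schubert v = c.sum fun w k => (k : MvPolynomial ℕ ℤ) * Schubert w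

/-- `w'` is the code scaling `N ∗ w`: the unique permutation whose Lehmer code is
`N` times the Lehmer code of `w`. -/
def IsCodeScale (N : ℕ) (w w' : Equiv.Perm ℕ) : Prop :=
  IsFinPerm w' ∧ ∀ i, lCode w' i = N * lCode w i

/-- the Rothe diagram of `w` (0-indexed). -/
def rothe (w : Equiv.Perm ℕ) : Set (ℕ × ℕ) := {p | p.2 < w p.1 ∧ p.1 < w.symm p.2}

/-- column `h` of the Rothe diagram of `w`. -/
def rotheCol (w : Equiv.Perm ℕ) (h : ℕ) : Set ℕ := {r | (r, h) ∈ rothe w}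

/-- the shaded columns of `D(w)` with respect to `k`: the columns `w r` for rows `r > k`. -/
def shadedCols (k : ℕ) (w : Equiv.Perm ℕ) : Set ℕ := {j | ∃ r, k < r ∧ w r = j}

/-- the position at which (the copies of) column `j` start after every shaded column
is replaced by `N` adjacent copies of itself. -/
noncomputable def stretchCol (k N : ℕ) (w : Equiv.Perm ℕ) (j : ℕ) : ℕ :=
  Set.ncard {h | h < j ∧ h ∉ shadedCols k w} + N * Set.ncard {h | h < j ∧ h ∈ shadedCols k w}

/-- `w'` is the bit scaling `N ⊗ w` with respect to `k`: the unique permutation in `S_∞`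
whose Rothe diagram is obtained from `D(w)` by replacing each shaded column by `N`
adjacent copies of itself. -/
def IsBitScale (k N : ℕ) (w w' : Equiv.Perm ℕ) : Prop :=
  IsFinPerm w' ∧
  rothe w' = {q | ∃ p ∈ rothe w, ∃ m,
    m < (if p.2 ∈ shadedCols k w then N else 1) ∧ q = (p.1, stretchCol k N w p.2 + m)}

/-- `D(u)` together with a copy of `D(v)` shifted `m` columns to the right. -/
def doubleDiagram (m : ℕ) (u v : Equiv.Perm ℕ) : Set (ℕ × ℕ) :=
  rothe u ∪ {q | ∃ p ∈ rothe v, q = (p.1, p.2 + m)}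

/-- `T` is an indicator tableau in `Tab^w_{u,v}` (for `u, v, w ∈ S_m`, all 0-indexed):
a filling of `D(u) ∪ D(v)` with entries in `{0, …, m-1}` such that the number of entries
equal to `i` is `lCode w i`, entries strictly increase down each column, and every entry
appearing in row `r` is at most `r`. -/
def IsIndicatorTableau (m : ℕ) (u v w : Equiv.Perm ℕ) (T : ℕ × ℕ → ℕ) : Prop :=
  (∀ p ∈ doubleDiagram m u v, T p < m) ∧
  (∀ i < m, Set.ncard {p | p ∈ doubleDiagram m u v ∧ T p = i} = lCode w i) ∧
  (∀ p ∈ doubleDiagram m u v, ∀ q ∈ doubleDiagram m u v, p.2 = q.2 → p.1 < q.1 → T p < T q) ∧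
  (∀ p ∈ doubleDiagram m u v, T p ≤ p.1)

section DividedDifferences

open MvPolynomial

/-- the action of `sᵢ` on polynomials. -/
noncomputable def simpleSwap (i : ℕ) : MvPolynomial ℕ ℤ →ₐ[ℤ] MvPolynomial ℕ ℤ :=
  rename (Equiv.swap i (i + 1))

@[simp] lemma simpleSwap_X (i a : ℕ) :
    simpleSwap i (X a) = X (Equiv.swap i (i + 1) a) := by
  simp [simpleSwap]

lemma simpleSwap_simpleSwap (i : ℕ) (f : MvPolynomial ℕ ℤ) :
    simpleSwap i (simpleSwap i f) = f := by
  simp [simpleSwap, rename_rename, ← Equiv.coe_trans, Equiv.swap_swap]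

lemma simpleSwap_isHomogeneous (i : ℕ) {m : ℕ} {f : MvPolynomial ℕ ℤ} (hf : f.IsHomogeneous m) :
    (simpleSwap i f).IsHomogeneous m :=
  hf.rename_isHomogeneous

lemma simpleSwap_comm {i k : ℕ} (h : i + 1 < k) (f : MvPolynomial ℕ ℤ) :
    simpleSwap i (simpleSwap k f) = simpleSwap k (simpleSwap i f) := by
  simp only [simpleSwap, rename_rename]
  congr 2
  funext a
  simp only [Function.comp, Equiv.swap_apply_def]
  grind

lemma simpleSwap_braid (i : ℕ) (f : MvPolynomial ℕ ℤ) :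
    simpleSwap i (simpleSwap (i + 1) (simpleSwap i f)) =
      simpleSwap (i + 1) (simpleSwap i (simpleSwap (i + 1) f)) := by
  simp only [simpleSwap, rename_rename]
  congr 2
  funext a
  simp only [Function.comp, Equiv.swap_apply_def]
  grind

/-- the simple root `xᵢ - xᵢ₊₁`. -/
noncomputable def simpleRoot (i : ℕ) : MvPolynomial ℕ ℤ := X i - X (i + 1)

lemma simpleRoot_ne_zero (i : ℕ) : simpleRoot i ≠ 0 := by
  intro h
  have := X_injective (R := ℤ) (sub_eq_zero.1 h)
  omega

lemma simpleRoot_dvd (i : ℕ) (f : MvPolynomial ℕ ℤ) :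
    simpleRoot i ∣ f - simpleSwap i f := by
  rw [← Ideal.mem_span_singleton, ← Ideal.Quotient.mk_eq_mk_iff_sub_mem]
  have key : (Ideal.Quotient.mkₐ ℤ (Ideal.span {simpleRoot i})) =
      (Ideal.Quotient.mkₐ ℤ (Ideal.span {simpleRoot i})).comp (simpleSwap i) := by
    have h1 : Ideal.Quotient.mk (Ideal.span {simpleRoot i}) (X i) =
        Ideal.Quotient.mk (Ideal.span {simpleRoot i}) (X (i + 1)) := by
      rw [Ideal.Quotient.mk_eq_mk_iff_sub_mem]
      exact Ideal.subset_span rfl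
    refine MvPolynomial.algHom_ext fun a => ?_
    simp only [AlgHom.comp_apply, simpleSwap_X, Ideal.Quotient.mkₐ_eq_mk]
    rcases eq_or_ne a i with rfl | h
    · simpa using h1
    rcases eq_or_ne a (i + 1) with rfl | h'
    · simpa using h1.symm
    · rw [Equiv.swap_apply_of_ne_of_ne h h']
  exact congrArg (fun φ => φ f) key

lemma divDiff_spec (i : ℕ) (f : MvPolynomial ℕ ℤ) :
    f - simpleSwap i f = simpleRoot i * divDiff i f := by
  have h : ∃ g, f - rename (Equiv.swap i (i + 1)) f =
      (X i - X (i + 1)) * g := simpleRoot_dvd i f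
  unfold divDiff
  rw [dif_pos h]
  exact h.choose_spec

lemma divDiff_unique {i : ℕ} {f g : MvPolynomial ℕ ℤ}
    (h : f - simpleSwap i f = simpleRoot i * g) : divDiff i f = g :=
  mul_left_cancel₀ (simpleRoot_ne_zero i) ((divDiff_spec i f).symm.trans h)

lemma divDiff_add (i : ℕ) (f g : MvPolynomial ℕ ℤ) :
    divDiff i (f + g) = divDiff i f + divDiff i g := by
  apply divDiff_unique
  rw [map_add, mul_add, ← divDiff_spec, ← divDiff_spec]
  ring

lemma divDiff_mul (i : ℕ) (f g : MvPolynomial ℕ ℤ) :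
    divDiff i (f * g) = simpleSwap i f * divDiff i g + divDiff i f * g := by
  apply divDiff_unique
  rw [map_mul]
  linear_combination simpleSwap i f * divDiff_spec i g + g * divDiff_spec i f

lemma divDiff_of_invariant {i : ℕ} {f : MvPolynomial ℕ ℤ} (h : simpleSwap i f = f) :
    divDiff i f = 0 :=
  divDiff_unique (by rw [h]; ring)

lemma divDiff_X_mul {i : ℕ} {f : MvPolynomial ℕ ℤ} (h : simpleSwap i f = f) :
    divDiff i (X i * f) = f := by
  apply divDiff_unique
  simp [h, simpleRoot]
  ring

lemma simpleSwap_simpleRoot (i : ℕ) : simpleSwap i (simpleRoot i) = -simpleRoot i := by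
  simp [simpleRoot]

lemma simpleSwap_divDiff (i : ℕ) (f : MvPolynomial ℕ ℤ) :
    simpleSwap i (divDiff i f) = divDiff i f := by
  apply mul_left_cancel₀ (simpleRoot_ne_zero i)
  have h := congrArg (simpleSwap i) (divDiff_spec i f)
  rw [map_sub, map_mul, simpleSwap_simpleSwap, simpleSwap_simpleRoot] at h
  linear_combination h + divDiff_spec i f

lemma divDiff_divDiff (i : ℕ) (f : MvPolynomial ℕ ℤ) : divDiff i (divDiff i f) = 0 :=
  divDiff_of_invariant (simpleSwap_divDiff i f)

lemma divDiff_comm {i k : ℕ} (h : i + 1 < k) (f : MvPolynomial ℕ ℤ) :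
    divDiff i (divDiff k f) = divDiff k (divDiff i f) := by
  have hik : simpleSwap i (simpleRoot k) = simpleRoot k := by
    rw [simpleRoot, map_sub, simpleSwap_X, simpleSwap_X,
      Equiv.swap_apply_of_ne_of_ne (by omega) (by omega),
      Equiv.swap_apply_of_ne_of_ne (by omega) (by omega)]
  have hki : simpleSwap k (simpleRoot i) = simpleRoot i := by
    rw [simpleRoot, map_sub, simpleSwap_X, simpleSwap_X,
      Equiv.swap_apply_of_ne_of_ne (by omega) (by omega),
      Equiv.swap_apply_of_ne_of_ne (by omega) (by omega)]
  apply mul_left_cancel₀ (mul_ne_zero (simpleRoot_ne_zero i) (simpleRoot_ne_zero k))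
  have h1 := divDiff_spec i (divDiff k f)
  have h2 := divDiff_spec k (divDiff i f)
  have h3 := congrArg (simpleSwap i) (divDiff_spec k f)
  have h4 := congrArg (simpleSwap k) (divDiff_spec i f)
  rw [map_sub, map_mul, hik] at h3
  rw [map_sub, map_mul, hki] at h4
  have h5 := simpleSwap_comm h f
  linear_combination -simpleRoot k * h1 + simpleRoot i * h2 - divDiff_spec k f
    + divDiff_spec i f + h3 - h4 + h5

lemma divDiff_braid (i : ℕ) (f : MvPolynomial ℕ ℤ) :
    divDiff i (divDiff (i + 1) (divDiff i f)) =
      divDiff (i + 1) (divDiff i (divDiff (i + 1) f)) := by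
  have swap_ab : simpleSwap i (simpleRoot (i + 1)) = simpleRoot i + simpleRoot (i + 1) := by
    rw [simpleRoot, simpleRoot, map_sub, simpleSwap_X, simpleSwap_X, Equiv.swap_apply_right,
      Equiv.swap_apply_of_ne_of_ne (by omega) (by omega)]
    ring
  have swap_ba : simpleSwap (i + 1) (simpleRoot i) = simpleRoot i + simpleRoot (i + 1) := by
    rw [simpleRoot, simpleRoot, map_sub, simpleSwap_X, simpleSwap_X, Equiv.swap_apply_left,
      Equiv.swap_apply_of_ne_of_ne (by omega) (by omega)]
    ring
  have hsum : simpleRoot i + simpleRoot (i + 1) ≠ 0 := by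
    rw [← swap_ab]
    intro h
    apply simpleRoot_ne_zero (i + 1)
    rw [← simpleSwap_simpleSwap i (simpleRoot (i + 1)), h, map_zero]
  have expand : ∀ (s t : ℕ), simpleSwap s (simpleRoot t) = simpleRoot s + simpleRoot t →
      simpleSwap t (simpleRoot s) = simpleRoot s + simpleRoot t → ∀ f,
      simpleRoot s * simpleRoot t * (simpleRoot s + simpleRoot t) *
        divDiff s (divDiff t (divDiff s f)) =
      (f - simpleSwap s f) - (simpleSwap t f - simpleSwap t (simpleSwap s f)) +
        (simpleSwap s (simpleSwap t f) - simpleSwap s (simpleSwap t (simpleSwap s f))) := by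
    intro s t hst hts f
    have h1 := divDiff_spec s (divDiff t (divDiff s f))
    have h2 := divDiff_spec t (divDiff s f)
    have h3 := divDiff_spec s f
    have h4 := congrArg (simpleSwap t) h3
    have h5 := congrArg (simpleSwap s) h2
    have h6 := congrArg (simpleSwap s) h4
    have h7 : simpleSwap s (simpleRoot s + simpleRoot t) = simpleRoot t := by
      rw [map_add, simpleSwap_simpleRoot, hst]; ring
    simp only [map_sub, map_mul, hts, hst, simpleSwap_divDiff s f, h7] at h4 h5 h6
    linear_combination -simpleRoot t * (simpleRoot s + simpleRoot t) * h1
      - (simpleRoot s + simpleRoot t) * h2 + simpleRoot t * h5 - h3 + h4 - h6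
  apply mul_left_cancel₀ (mul_ne_zero (mul_ne_zero (simpleRoot_ne_zero i)
    (simpleRoot_ne_zero (i + 1))) hsum)
  rw [expand i (i + 1) swap_ab swap_ba]
  have h := expand (i + 1) i (by rw [swap_ba, add_comm]) (by rw [swap_ab, add_comm]) f
  linear_combination -simpleSwap_braid i f - h

lemma homogeneousComponent_simpleRoot_mul (i m : ℕ) (g : MvPolynomial ℕ ℤ) :
    homogeneousComponent (m + 1) (simpleRoot i * g) =
      simpleRoot i * homogeneousComponent m g := by
  have hroot : (simpleRoot i).IsHomogeneous 1 := (isHomogeneous_X ℤ i).sub (isHomogeneous_X ℤ _)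
  induction g using MvPolynomial.induction_on' with
  | monomial e c =>
    have h1 : (monomial e c : MvPolynomial ℕ ℤ).IsHomogeneous e.degree :=
      isHomogeneous_monomial c rfl
    have h2 := hroot.mul h1
    rw [homogeneousComponent_of_mem h1, homogeneousComponent_of_mem h2]
    by_cases h : m = e.degree
    · rw [if_pos (by omega), if_pos h]
    · rw [if_neg (by omega), if_neg h, mul_zero]
  | add p q hp hq => rw [mul_add, map_add, map_add, hp, hq, mul_add]

lemma divDiff_isHomogeneous {i m : ℕ} {f : MvPolynomial ℕ ℤ} (hf : f.IsHomogeneous (m + 1)) :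
    (divDiff i f).IsHomogeneous m := by
  have h : divDiff i f = homogeneousComponent m (divDiff i f) := by
    apply divDiff_unique
    rw [← homogeneousComponent_simpleRoot_mul, ← divDiff_spec, homogeneousComponent_of_mem
      (hf.sub (simpleSwap_isHomogeneous i hf)), if_pos rfl]
  rw [h]
  exact homogeneousComponent_isHomogeneous m _

lemma divDiff_of_isHomogeneous_zero (i : ℕ) {f : MvPolynomial ℕ ℤ} (hf : f.IsHomogeneous 0) :
    divDiff i f = 0 := by
  apply divDiff_of_invariant
  rw [totalDegree_eq_zero_iff_eq_C.1 ((totalDegree_zero_iff_isHomogeneous _).2 hf), simpleSwap,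
    rename_C]

/-- the divided difference of a linear form is the difference of two coefficients. -/
lemma divDiff_linear (k : ℕ) {f : MvPolynomial ℕ ℤ} (hf : f.IsHomogeneous 1) :
    divDiff k f = C (coeff (Finsupp.single k 1) f - coeff (Finsupp.single (k + 1) 1) f) := by
  obtain ⟨c, hc⟩ : ∃ c, divDiff k f = C c :=
    ⟨_, totalDegree_eq_zero_iff_eq_C.1
      ((totalDegree_zero_iff_isHomogeneous _).2 (divDiff_isHomogeneous hf))⟩
  have h := congrArg (coeff (Finsupp.single k 1)) (divDiff_spec k f)
  have h2 := coeff_rename_mapDomain (Equiv.swap k (k + 1)) (Equiv.injective _) f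
    (Finsupp.single (k + 1) 1)
  rw [Finsupp.mapDomain_single, Equiv.swap_apply_right] at h2
  rw [hc, mul_comm, coeff_C_mul, coeff_sub, simpleSwap, h2, simpleRoot, coeff_sub, coeff_X,
    coeff_X, if_pos rfl, if_neg (by simp [Finsupp.single_left_inj])] at h
  rw [hc, h]
  simp

end DividedDifferences

section Length

open Equiv

lemma InSymm.mono {n m : ℕ} {w : Perm ℕ} (h : InSymm n w) (hnm : n ≤ m) : InSymm m w :=
  fun p hp => h p (hnm.trans hp)

lemma InSymm.lt {n m : ℕ} {w : Perm ℕ} (h : InSymm n w) (hm : m < n) : w m < n := by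
  by_contra hc
  have := w.injective (h (w m) (by omega))
  omega

lemma InSymm.mul_swap {n a b : ℕ} {w : Perm ℕ} (h : InSymm n w) (ha : a < n) (hb : b < n) :
    InSymm n (w * swap a b) := by
  intro m hm
  rw [Perm.mul_apply, swap_apply_of_ne_of_ne (by omega) (by omega), h m hm]

lemma IsFinPerm.mul_swap {w : Perm ℕ} (h : IsFinPerm w) (a b : ℕ) :
    IsFinPerm (w * swap a b) := by
  obtain ⟨n, hn⟩ := h
  exact ⟨n + a + b + 1, (hn.mono (by omega)).mul_swap (by omega) (by omega)⟩

/-- the set of inversions of `w`. -/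
def inversions (w : Perm ℕ) : Set (ℕ × ℕ) := {p | p.1 < p.2 ∧ w p.2 < w p.1}

lemma InSymm.inversions_subset {n : ℕ} {w : Perm ℕ} (h : InSymm n w) :
    inversions w ⊆ ↑(Finset.range n ×ˢ Finset.range n) := by
  rintro ⟨p, q⟩ ⟨h1, h2⟩
  simp only at h1 h2
  have hq : q < n := by
    by_contra hq
    have e := h q (by omega)
    by_cases hp : p < n
    · have := h.lt hp
      omega
    · have := h p (by omega)
      omega
  simp only [Finset.coe_product, Finset.coe_range, Set.mem_prod, Set.mem_Iio]
  omega

lemma IsFinPerm.finite_inversions {w : Perm ℕ} (h : IsFinPerm w) : (inversions w).Finite :=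
  (Finset.finite_toSet _).subset h.choose_spec.inversions_subset

lemma InSymm.invLen_le {n : ℕ} {w : Perm ℕ} (h : InSymm n w) : invLen w ≤ n * n := by
  have := Set.ncard_le_ncard h.inversions_subset (Finset.finite_toSet _)
  rwa [Set.ncard_coe_finset, Finset.card_product, Finset.card_range] at this

lemma invLen_mul_swap_of_lt {w : Perm ℕ} (hw : IsFinPerm w) {k : ℕ} (hk : w k < w (k + 1)) :
    invLen (w * swap k (k + 1)) = invLen w + 1 := by
  have h : inversions (w * swap k (k + 1)) =
      insert (k, k + 1) (Prod.map (swap k (k + 1)) (swap k (k + 1)) '' inversions w) := by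
    ext ⟨p, q⟩
    simp only [inversions, Set.mem_ofPred_eq, Perm.mul_apply, Set.mem_insert_iff, Prod.mk.injEq,
      Set.mem_image, Prod.exists, Prod.map_apply]
    constructor
    · rintro ⟨h1, h2⟩
      by_cases h3 : p = k ∧ q = k + 1
      · exact Or.inl h3
      · refine Or.inr ⟨swap k (k + 1) p, swap k (k + 1) q, ⟨?_, h2⟩, by simp, by simp⟩
        simp only [swap_apply_def]
        grind
    · rintro (⟨rfl, rfl⟩ | ⟨a, b, ⟨h1, h2⟩, rfl, rfl⟩)
      · simpa using hk
      · refine ⟨?_, by simpa using h2⟩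
        have : ¬ (a = k ∧ b = k + 1) := by
          rintro ⟨rfl, rfl⟩
          omega
        simp only [swap_apply_def]
        grind
  change (inversions _).ncard = (inversions _).ncard + 1
  rw [h, Set.ncard_insert_of_notMem _ (hw.finite_inversions.image _),
    Set.ncard_image_of_injective]
  · exact Function.Injective.prodMap (Equiv.injective _) (Equiv.injective _)
  · rintro ⟨⟨a, b⟩, ⟨h1, -⟩, h3⟩
    simp only [Prod.map_apply, Prod.mk.injEq, swap_apply_eq_iff, swap_apply_left,
      swap_apply_right] at h3 h1
    omega

lemma mul_swap_mul_swap (w : Perm ℕ) (a b : ℕ) : w * swap a b * swap a b = w := by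
  rw [mul_assoc, swap_mul_self, mul_one]

lemma invLen_mul_swap_of_gt {w : Perm ℕ} (hw : IsFinPerm w) {k : ℕ} (hk : w (k + 1) < w k) :
    invLen (w * swap k (k + 1)) + 1 = invLen w := by
  rw [← invLen_mul_swap_of_lt (k := k) (hw.mul_swap k (k + 1)) (by simpa using hk),
    mul_swap_mul_swap]

lemma apply_lt_or_gt (w : Perm ℕ) (k : ℕ) : w k < w (k + 1) ∨ w (k + 1) < w k :=
  lt_or_gt_of_ne fun h => by have := w.injective h; omega

/-- swapping the values at the ends of an ascending pair increases the length. -/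
lemma invLen_lt_mul_swap {w : Perm ℕ} (hw : IsFinPerm w) {a b : ℕ} (hab : a < b)
    (h : w a < w b) : invLen w < invLen (w * swap a b) := by
  obtain ⟨m, rfl⟩ : ∃ m, b = a + 1 + m := ⟨b - (a + 1), by omega⟩
  clear hab
  induction m generalizing a w with
  | zero => rw [add_zero] at h ⊢; rw [invLen_mul_swap_of_lt hw h]; omega
  | succ m ih =>
    set b := a + 1 + (m + 1) with hb
    have hb' : b = a + 1 + 1 + m := by omega
    set w₁ := w * swap a (a + 1) with hw₁
    set w₂ := w₁ * swap (a + 1) b with hw₂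
    have e1 : w₁ (a + 1) = w a := by simp [hw₁]
    have e2 : w₁ b = w b := by
      rw [hw₁, Perm.mul_apply, swap_apply_of_ne_of_ne (by omega) (by omega)]
    have e3 : w₂ a = w (a + 1) := by
      rw [hw₂, Perm.mul_apply, swap_apply_of_ne_of_ne (by omega) (by omega)]
      simp [hw₁]
    have e4 : w₂ (a + 1) = w b := by rw [hw₂, Perm.mul_apply, swap_apply_left, e2]
    have e5 : w₂ * swap a (a + 1) = w * swap a b := by
      rw [hw₂, hw₁, mul_assoc, mul_assoc]
      congr 1
      ext x
      simp only [Perm.mul_apply, swap_apply_def]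
      grind
    have f₁ : IsFinPerm w₁ := hw.mul_swap _ _
    have f₂ : IsFinPerm w₂ := f₁.mul_swap _ _
    have h12 : invLen w₁ < invLen w₂ := by
      rw [hw₂, hb']
      exact ih f₁ (by rw [← hb', e1, e2]; exact h)
    rw [← e5]
    rcases apply_lt_or_gt w a with h1 | h1 <;> rcases apply_lt_or_gt w₂ a with h2 | h2
    · have : invLen w₁ = invLen w + 1 := invLen_mul_swap_of_lt hw h1
      have := invLen_mul_swap_of_lt f₂ h2
      omega
    · have : invLen w₁ = invLen w + 1 := invLen_mul_swap_of_lt hw h1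
      have := invLen_mul_swap_of_gt f₂ h2
      omega
    · have : invLen w₁ + 1 = invLen w := invLen_mul_swap_of_gt hw h1
      have := invLen_mul_swap_of_lt f₂ h2
      omega
    · rw [e3, e4] at h2
      omega

lemma apply_lt_of_cover {w : Perm ℕ} (hw : IsFinPerm w) {a b : ℕ} (hab : a < b)
    (h : invLen (w * swap a b) = invLen w + 1) : w a < w b := by
  by_contra hc
  have hne : w a ≠ w b := fun e => hab.ne (w.injective e)
  have := invLen_lt_mul_swap (hw.mul_swap a b) hab (by simp; omega)
  rw [mul_swap_mul_swap] at this
  omega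

/-- a Bruhat cover `w ⋖ w·t_{ab}` has no intermediate value at an intermediate position. -/
lemma not_between_of_cover {w : Perm ℕ} (hw : IsFinPerm w) {a b c : ℕ} (hac : a < c)
    (hcb : c < b) (h : invLen (w * swap a b) = invLen w + 1) : ¬ (w a < w c ∧ w c < w b) := by
  rintro ⟨h1, h2⟩
  set w₁ := w * swap a c with hw₁
  set w₂ := w₁ * swap a b with hw₂
  have f₁ : IsFinPerm w₁ := hw.mul_swap _ _
  have f₂ : IsFinPerm w₂ := f₁.mul_swap _ _
  have e1 : w₁ a = w c := by simp [hw₁]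
  have e2 : w₁ b = w b := by
    rw [hw₁, Perm.mul_apply, swap_apply_of_ne_of_ne (by omega) (by omega)]
  have e3 : w₂ c = w a := by
    rw [hw₂, Perm.mul_apply, swap_apply_of_ne_of_ne (by omega) (by omega)]
    simp [hw₁]
  have e4 : w₂ b = w c := by rw [hw₂, Perm.mul_apply, swap_apply_right, e1]
  have e5 : w₂ * swap c b = w * swap a b := by
    rw [hw₂, hw₁, mul_assoc, mul_assoc]
    congr 1
    ext x
    simp only [Perm.mul_apply, swap_apply_def]
    grind
  have l1 : invLen w < invLen w₁ := invLen_lt_mul_swap hw hac h1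
  have l2 : invLen w₁ < invLen w₂ :=
    invLen_lt_mul_swap f₁ (hac.trans hcb) (by rw [e1, e2]; exact h2)
  have l3 := invLen_lt_mul_swap f₂ hcb (by rw [e3, e4]; exact h1)
  rw [e5] at l3
  omega

lemma invLen_one : invLen 1 = 0 := by
  change (inversions 1).ncard = 0
  have h : inversions 1 = ∅ := by
    ext ⟨p, q⟩
    simp only [inversions, Perm.one_apply, Set.mem_ofPred_eq, Set.mem_empty_iff_false, iff_false]
    omega
  rw [h, Set.ncard_empty]

lemma isFinPerm_one : IsFinPerm 1 := ⟨0, fun _ _ => rfl⟩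

/-- a permutation of `ℕ` without descents is the identity. -/
lemma exists_descent {w : Perm ℕ} (h1 : w ≠ 1) : ∃ k, w (k + 1) < w k := by
  by_contra! hc
  have hmono : StrictMono w := strictMono_nat_of_lt_succ fun k =>
    lt_of_le_of_ne (hc k) fun e => by have := w.injective e; omega
  apply h1
  ext m
  have := congrFun (Subsingleton.elim (hmono.orderIsoOfSurjective w w.surjective)
    (OrderIso.refl ℕ) ▸ rfl : (hmono.orderIsoOfSurjective w w.surjective : ℕ → ℕ) =
      (OrderIso.refl ℕ : ℕ → ℕ)) m
  simpa using this

lemma eq_one_of_invLen_eq_zero {w : Perm ℕ} (hw : IsFinPerm w) (h : invLen w = 0) : w = 1 := by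
  by_contra h1
  obtain ⟨k, hk⟩ := exists_descent h1
  have := invLen_mul_swap_of_gt hw hk
  omega

/-- the length of the longest element of `S_n`. -/
lemma invLen_longest {n : ℕ} {w : Perm ℕ} (hw : InSymm n w)
    (h : ∀ p q, p < q → q < n → w q < w p) : invLen w = ∑ p ∈ Finset.range n, (n - 1 - p) := by
  have hs : inversions w = ↑((Finset.range n).biUnion
      fun p => (Finset.Ioo p n).image fun q => (p, q)) := by
    ext ⟨p, q⟩
    simp only [Finset.coe_biUnion, Finset.coe_range, Set.mem_Iio, Finset.coe_image, Set.mem_iUnion,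
      Set.mem_image, Finset.coe_Ioo, Set.mem_Ioo, Prod.mk.injEq, exists_prop]
    constructor
    · intro hpq
      have := hw.inversions_subset hpq
      simp only [Finset.coe_product, Finset.coe_range, Set.mem_prod, Set.mem_Iio] at this
      exact ⟨p, this.1, q, ⟨hpq.1, this.2⟩, rfl, rfl⟩
    · rintro ⟨p, hp, q, ⟨h1, h2⟩, rfl, rfl⟩
      exact ⟨h1, h p q h1 h2⟩
  change (inversions w).ncard = _
  rw [hs, Set.ncard_coe_finset, Finset.card_biUnion]
  · refine Finset.sum_congr rfl fun p _ => ?_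
    rw [Finset.card_image_of_injective _ (Prod.mk_right_injective p), Nat.card_Ioo]
    omega
  · intro p _ q _ hpq
    rw [Function.onFun, Finset.disjoint_left]
    simp only [Finset.mem_image, not_exists, not_and]
    rintro _ ⟨a, -, rfl⟩ b - hb
    simp only [Prod.mk.injEq] at hb
    exact hpq hb.1.symm

end Length

section Schubert

open Equiv MvPolynomial

lemma schubertAux_succ {n : ℕ} {w : Perm ℕ} (h : ∃ i, i + 1 < n ∧ w i < w (i + 1)) :
    ∃ i, (i + 1 < n ∧ w i < w (i + 1)) ∧ ∀ m, SchubertAux n (m + 1) w =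
      divDiff i (SchubertAux n m (w * swap i (i + 1))) :=
  ⟨h.choose, h.choose_spec, fun m => by rw [SchubertAux, dif_pos h]⟩

lemma schubertAux_of_no_ascent {n : ℕ} (k : ℕ) {w : Perm ℕ}
    (h : ¬ ∃ i, i + 1 < n ∧ w i < w (i + 1)) : SchubertAux n k w = staircase n := by
  cases k with
  | zero => rfl
  | succ k => rw [SchubertAux, dif_neg h]

lemma schubertAux_fuel {n : ℕ} (k : ℕ) {w : Perm ℕ} (hw : InSymm n w)
    (hk : n * n ≤ invLen w + k) : SchubertAux n (k + 1) w = SchubertAux n k w := by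
  induction k generalizing w with
  | zero =>
    have h : ¬ ∃ i, i + 1 < n ∧ w i < w (i + 1) := by
      rintro ⟨i, hi, h⟩
      have h1 := invLen_mul_swap_of_lt ⟨n, hw⟩ h
      have h2 := (hw.mul_swap (a := i) (b := i + 1) (by omega) hi).invLen_le
      omega
    rw [schubertAux_of_no_ascent _ h, schubertAux_of_no_ascent _ h]
  | succ k ih =>
    by_cases h : ∃ i, i + 1 < n ∧ w i < w (i + 1)
    · obtain ⟨i, ⟨hi, hlt⟩, e⟩ := schubertAux_succ h
      rw [e, e, ih (hw.mul_swap (by omega) hi)]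
      rw [invLen_mul_swap_of_lt ⟨n, hw⟩ hlt]
      omega
    · rw [schubertAux_of_no_ascent _ h, schubertAux_of_no_ascent _ h]

/-- the Schubert polynomial computed inside `S_n`. -/
noncomputable def schubertIn (n : ℕ) (w : Perm ℕ) : MvPolynomial ℕ ℤ := SchubertAux n (n * n) w

/-- the recursion holds at some ascent. -/
lemma exists_schubertIn_eq {n : ℕ} {w : Perm ℕ} (hw : InSymm n w)
    (h : ∃ i, i + 1 < n ∧ w i < w (i + 1)) : ∃ i, (i + 1 < n ∧ w i < w (i + 1)) ∧
      schubertIn n w = divDiff i (schubertIn n (w * swap i (i + 1))) := by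
  obtain ⟨i, hi, e⟩ := schubertAux_succ h
  exact ⟨i, hi, by rw [schubertIn, schubertIn, ← e, schubertAux_fuel _ hw (by omega)]⟩

lemma schubertIn_of_no_ascent {n : ℕ} {w : Perm ℕ}
    (h : ¬ ∃ i, i + 1 < n ∧ w i < w (i + 1)) : schubertIn n w = staircase n :=
  schubertAux_of_no_ascent _ h

lemma swap_mul_swap_comm {i k : ℕ} (h : i + 1 < k) (w : Perm ℕ) :
    w * swap i (i + 1) * swap k (k + 1) = w * swap k (k + 1) * swap i (i + 1) := by
  rw [mul_assoc, mul_assoc]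
  congr 1
  ext x
  simp only [Perm.mul_apply, swap_apply_def]
  grind

lemma swap_mul_swap_braid (i : ℕ) (w : Perm ℕ) :
    w * swap i (i + 1) * swap (i + 1) (i + 1 + 1) * swap i (i + 1) =
      w * swap (i + 1) (i + 1 + 1) * swap i (i + 1) * swap (i + 1) (i + 1 + 1) := by
  simp only [mul_assoc]
  congr 1
  ext x
  simp only [Perm.mul_apply, swap_apply_def]
  grind

/-- the recursion holds at every ascent, whichever ascents are chosen along the way. -/
lemma schubertIn_eq_divDiff {n : ℕ} {w : Perm ℕ} (hw : InSymm n w) {i : ℕ} (hi : i + 1 < n)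
    (h : w i < w (i + 1)) : schubertIn n w = divDiff i (schubertIn n (w * swap i (i + 1))) := by
  obtain ⟨m, hm⟩ : ∃ m, n * n ≤ invLen w + m := ⟨n * n, by omega⟩
  induction m using Nat.strong_induction_on generalizing w i with
  | _ m ih =>
  have step : ∀ {x : Perm ℕ}, InSymm n x → invLen w < invLen x → ∀ {a : ℕ}, a + 1 < n →
      x a < x (a + 1) → schubertIn n x = divDiff a (schubertIn n (x * swap a (a + 1))) := by
    intro x hx hlt a ha hxa
    have hle := hx.invLen_le
    exact ih (n * n - invLen x) (by omega) hx ha hxa (by omega)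
  have up : ∀ {x : Perm ℕ}, InSymm n x → ∀ {a : ℕ}, a + 1 < n → x a < x (a + 1) →
      InSymm n (x * swap a (a + 1)) ∧ invLen x < invLen (x * swap a (a + 1)) := by
    intro x hx a ha hxa
    exact ⟨hx.mul_swap (by omega) ha, by rw [invLen_mul_swap_of_lt ⟨n, hx⟩ hxa]; omega⟩
  have far : ∀ a b, a + 1 < b → b + 1 < n → w a < w (a + 1) → w b < w (b + 1) →
      divDiff a (schubertIn n (w * swap a (a + 1))) =
        divDiff b (schubertIn n (w * swap b (b + 1))) := by
    intro a b hab hb hwa hwb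
    obtain ⟨ha1, ha2⟩ := up hw (a := a) (by omega) hwa
    obtain ⟨hb1, hb2⟩ := up hw hb hwb
    rw [step ha1 ha2 hb, step hb1 hb2 (a := a) (by omega), swap_mul_swap_comm hab,
      divDiff_comm hab]
    · rwa [Perm.mul_apply, Perm.mul_apply, swap_apply_of_ne_of_ne (by omega) (by omega),
        swap_apply_of_ne_of_ne (by omega) (by omega)]
    · rwa [Perm.mul_apply, Perm.mul_apply, swap_apply_of_ne_of_ne (by omega) (by omega),
        swap_apply_of_ne_of_ne (by omega) (by omega)]
  have near : ∀ a, a + 1 + 1 < n → w a < w (a + 1) → w (a + 1) < w (a + 1 + 1) →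
      divDiff a (schubertIn n (w * swap a (a + 1))) =
        divDiff (a + 1) (schubertIn n (w * swap (a + 1) (a + 1 + 1))) := by
    intro a ha hwa hwb
    have v1 : swap a (a + 1) (a + 1 + 1) = a + 1 + 1 :=
      swap_apply_of_ne_of_ne (by omega) (by omega)
    have v2 : swap (a + 1) (a + 1 + 1) a = a := swap_apply_of_ne_of_ne (by omega) (by omega)
    obtain ⟨ha1, ha2⟩ := up hw (a := a) (by omega) hwa
    have hxa : (w * swap a (a + 1)) (a + 1) < (w * swap a (a + 1)) (a + 1 + 1) := by
      simp only [Perm.mul_apply, swap_apply_right, v1]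
      omega
    obtain ⟨ha3, ha4⟩ := up ha1 (a := a + 1) ha hxa
    obtain ⟨hb1, hb2⟩ := up hw (a := a + 1) ha hwb
    have hxb : (w * swap (a + 1) (a + 1 + 1)) a < (w * swap (a + 1) (a + 1 + 1)) (a + 1) := by
      simp only [Perm.mul_apply, swap_apply_left, v2]
      omega
    obtain ⟨hb3, hb4⟩ := up hb1 (a := a) (by omega) hxb
    rw [step ha1 ha2 (a := a + 1) ha hxa, step ha3 (ha2.trans ha4) (a := a) (by omega),
      step hb1 hb2 (a := a) (by omega) hxb, step hb3 (hb2.trans hb4) (a := a + 1) ha,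
      divDiff_braid, swap_mul_swap_braid]
    · simpa only [Perm.mul_apply, swap_apply_left, swap_apply_right, v1, v2] using hwa
    · simpa only [Perm.mul_apply, swap_apply_left, swap_apply_right, v1, v2] using hwb
  obtain ⟨c, ⟨hc, hwc⟩, e⟩ := exists_schubertIn_eq hw ⟨i, hi, h⟩
  rw [e]
  rcases lt_trichotomy c i with hci | rfl | hci
  · rcases (Nat.succ_le_of_lt hci).eq_or_lt with rfl | hci
    · exact near c hi hwc h
    · exact far c i hci hi hwc h
  · rfl
  · rcases (Nat.succ_le_of_lt hci).eq_or_lt with rfl | hci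
    · exact (near i hc h hwc).symm
    · exact (far i c hci hc h hwc).symm

lemma lt_of_no_ascent {n : ℕ} {w : Perm ℕ} (h : ¬ ∃ i, i + 1 < n ∧ w i < w (i + 1))
    {p q : ℕ} (hpq : p < q) (hq : q < n) : w q < w p := by
  push Not at h
  have step : ∀ r, r + 1 < n → w (r + 1) < w r := fun r hr =>
    (apply_lt_or_gt w r).resolve_left (not_lt.2 (h r hr))
  induction q, hpq using Nat.le_induction with
  | base => exact step p hq
  | succ q hpq ih => exact (step q hq).trans (ih (by omega))

/-- interpolates between `staircase (n + 1)` (`j = 0`) and `staircase n` (`j = n`). -/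
noncomputable def partialStaircase (n j : ℕ) : MvPolynomial ℕ ℤ :=
  ∏ p ∈ Finset.range (n + 1), X p ^ (if p < j then n - 1 - p else n - p)

lemma X_mul_partialStaircase_succ {n j : ℕ} (h : j < n) :
    X j * partialStaircase n (j + 1) = partialStaircase n j := by
  have hj : j ∈ Finset.range (n + 1) := Finset.mem_range.2 (by omega)
  rw [partialStaircase, partialStaircase, ← Finset.mul_prod_erase _ _ hj,
    ← Finset.mul_prod_erase _ _ hj, ← mul_assoc]
  congr 1
  · rw [if_pos (by omega), if_neg (by omega), ← pow_succ']
    congr 1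
    omega
  · refine Finset.prod_congr rfl fun p hp => ?_
    have := Finset.ne_of_mem_erase hp
    congr 1
    split_ifs <;> omega

lemma simpleSwap_partialStaircase_succ {n j : ℕ} (h : j < n) :
    simpleSwap j (partialStaircase n (j + 1)) = partialStaircase n (j + 1) := by
  rw [partialStaircase, map_prod]
  refine Finset.prod_equiv (swap j (j + 1)) (fun p => ?_) (fun p _ => ?_)
  · simp only [Finset.mem_range, swap_apply_def]
    split_ifs <;> omega
  · rw [map_pow, simpleSwap_X]
    congr 1
    simp only [swap_apply_def]
    split_ifs <;> omega

lemma schubertIn_partialStaircase {n j : ℕ} (hj : j ≤ n) {w : Perm ℕ} (hw : InSymm (n + 1) w)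
    (hwj : w j = n) (hdec : ∀ p q, p < q → q ≤ n → p ≠ j → q ≠ j → w q < w p) :
    schubertIn (n + 1) w = partialStaircase n j := by
  induction j generalizing w with
  | zero =>
    rw [schubertIn_of_no_ascent, staircase, partialStaircase]
    · refine Finset.prod_congr rfl fun p _ => ?_
      rw [if_neg (by omega), Nat.add_sub_cancel]
    · rintro ⟨i, hi, h⟩
      rcases Nat.eq_zero_or_pos i with rfl | h0
      · have := hw.lt hi
        omega
      · have := hdec i (i + 1) (by omega) (by omega) (by omega) (by omega)
        omega
  | succ j ih =>
    have hlt : w j < w (j + 1) := by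
      have h1 := hw.lt (m := j) (by omega)
      have h2 : w j ≠ w (j + 1) := fun e => by have := w.injective e; omega
      omega
    rw [schubertIn_eq_divDiff hw (by omega) hlt, ih (by omega) (hw.mul_swap (by omega) (by omega)),
      ← X_mul_partialStaircase_succ hj, divDiff_X_mul (simpleSwap_partialStaircase_succ hj)]
    · simpa using hwj
    · intro p q hpq hq hpj hqj
      simp only [Perm.mul_apply]
      apply hdec
      all_goals simp only [swap_apply_def]
      all_goals split_ifs <;> omega

lemma schubertIn_succ {n : ℕ} {w : Perm ℕ} (hw : InSymm n w) :
    schubertIn (n + 1) w = schubertIn n w := by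
  obtain ⟨m, hm⟩ : ∃ m, n * n ≤ invLen w + m := ⟨n * n, by omega⟩
  induction m using Nat.strong_induction_on generalizing w with
  | _ m ih =>
  by_cases h : ∃ i, i + 1 < n ∧ w i < w (i + 1)
  · obtain ⟨i, hi, h⟩ := h
    have hw' : InSymm n (w * swap i (i + 1)) := hw.mul_swap (by omega) hi
    have hlen := invLen_mul_swap_of_lt ⟨n, hw⟩ h
    have hle := hw'.invLen_le
    rw [schubertIn_eq_divDiff hw hi h, schubertIn_eq_divDiff (hw.mono (Nat.le_succ n)) (by omega) h,
      ih (n * n - invLen (w * swap i (i + 1))) (by omega) hw' (by omega)]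
  · rw [schubertIn_of_no_ascent h, schubertIn_partialStaircase le_rfl (hw.mono (Nat.le_succ n))
      (hw n le_rfl), partialStaircase, staircase, Finset.prod_range_succ]
    · rw [if_neg (lt_irrefl n), Nat.sub_self, pow_zero, mul_one]
      exact Finset.prod_congr rfl fun p hp => by rw [if_pos (Finset.mem_range.1 hp)]
    · intro p q hpq hq _ hqn
      exact lt_of_no_ascent h hpq (by omega)

lemma schubertIn_eq_of_le {n m : ℕ} (hnm : n ≤ m) {w : Perm ℕ} (hw : InSymm n w) :
    schubertIn m w = schubertIn n w := by
  induction m, hnm using Nat.le_induction with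
  | base => rfl
  | succ m hnm ih => rw [schubertIn_succ (hw.mono hnm), ih]

lemma schubert_eq_schubertIn {n : ℕ} {w : Perm ℕ} (hw : InSymm n w) :
    Schubert w = schubertIn n w := by
  have h : IsFinPerm w := ⟨n, hw⟩
  rw [Schubert, dif_pos h]
  change schubertIn h.choose w = _
  rw [← schubertIn_eq_of_le (le_max_left h.choose n) h.choose_spec,
    schubertIn_eq_of_le (le_max_right h.choose n) hw]

lemma schubert_one : Schubert 1 = 1 := by
  rw [schubert_eq_schubertIn (n := 0) (fun _ _ => rfl), schubertIn_of_no_ascent (by simp)]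
  simp [staircase]

lemma divDiff_schubert_of_gt {w : Perm ℕ} (hw : IsFinPerm w) {k : ℕ} (h : w (k + 1) < w k) :
    divDiff k (Schubert w) = Schubert (w * swap k (k + 1)) := by
  obtain ⟨n, hn⟩ := hw
  have h1 : InSymm (n + k + 2) w := hn.mono (by omega)
  have h2 : InSymm (n + k + 2) (w * swap k (k + 1)) := h1.mul_swap (by omega) (by omega)
  rw [schubert_eq_schubertIn h1, schubert_eq_schubertIn h2,
    schubertIn_eq_divDiff h2 (i := k) (by omega) (by simpa using h), mul_swap_mul_swap]

lemma divDiff_schubert_of_lt {w : Perm ℕ} (hw : IsFinPerm w) {k : ℕ} (h : w k < w (k + 1)) :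
    divDiff k (Schubert w) = 0 := by
  rw [← mul_swap_mul_swap w k (k + 1), ← divDiff_schubert_of_gt (hw.mul_swap k (k + 1)),
    divDiff_divDiff]
  simpa using h

lemma schubert_isHomogeneous {w : Perm ℕ} (hw : IsFinPerm w) :
    (Schubert w).IsHomogeneous (invLen w) := by
  obtain ⟨n, hn⟩ := hw
  obtain ⟨m, hm⟩ : ∃ m, n * n ≤ invLen w + m := ⟨n * n, by omega⟩
  induction m using Nat.strong_induction_on generalizing w with
  | _ m ih =>
  by_cases h : ∃ i, i + 1 < n ∧ w i < w (i + 1)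
  · obtain ⟨i, hi, h⟩ := h
    have hw' : InSymm n (w * swap i (i + 1)) := hn.mul_swap (by omega) hi
    have hlen := invLen_mul_swap_of_lt ⟨n, hn⟩ h
    have hle := hw'.invLen_le
    have := ih (n * n - invLen (w * swap i (i + 1))) (by omega) hw' (by omega)
    rw [schubert_eq_schubertIn hn, schubertIn_eq_divDiff hn hi h, ← schubert_eq_schubertIn hw']
    exact divDiff_isHomogeneous (hlen ▸ this)
  · rw [schubert_eq_schubertIn hn, schubertIn_of_no_ascent h,
      invLen_longest hn (fun p q => lt_of_no_ascent h)]
    exact IsHomogeneous.prod _ _ _ fun p _ => isHomogeneous_X_pow p _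

end Schubert

section Coefficients

open Equiv MvPolynomial

lemma gt_of_cover_of_gt {u : Perm ℕ} (hu : IsFinPerm u) {a b k : ℕ} (hab : a < b)
    (hcov : invLen (u * swap a b) = invLen u + 1)
    (hk : (u * swap a b) (k + 1) < (u * swap a b) k) (hne : ¬ (a = k ∧ b = k + 1)) :
    u (k + 1) < u k := by
  have hlt := apply_lt_of_cover hu hab hcov
  have hbt : ∀ c, a < c → c < b → ¬ (u a < u c ∧ u c < u b) := fun c h1 h2 =>
    not_between_of_cover hu h1 h2 hcov
  have hab' : u a ≠ u b := hlt.ne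
  rcases apply_lt_or_gt u k with h | h
  swap
  · exact h
  have inj : ∀ x y, u x = u y → x = y := fun x y e => u.injective e
  simp only [Perm.mul_apply, swap_apply_def] at hk
  have := hbt k
  have := hbt (k + 1)
  grind

/-- extraction of the coefficient of `𝔖_w`: there is a functional dual to `w` among the Schubert
polynomials, it vanishes in all degrees except `ℓ(w)`, and it computes the product of a linear form
with `𝔖_u` for every Bruhat cover `u ⋖ w`. -/
lemma exists_dual {w : Perm ℕ} (hw : IsFinPerm w) :
    ∃ φ : MvPolynomial ℕ ℤ →+ ℤ,
      (∀ x, IsFinPerm x → φ (Schubert x) = if x = w then 1 else 0) ∧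
      (∀ m f, f.IsHomogeneous m → m ≠ invLen w → φ f = 0) ∧
      (∀ u a b, IsFinPerm u → a < b → w = u * swap a b → invLen w = invLen u + 1 →
        ∀ f, f.IsHomogeneous 1 → φ (f * Schubert u) =
          coeff (Finsupp.single a 1) f - coeff (Finsupp.single b 1) f) := by
  obtain ⟨l, hl⟩ : ∃ l, invLen w = l := ⟨_, rfl⟩
  induction l generalizing w with
  | zero =>
    obtain rfl := eq_one_of_invLen_eq_zero hw hl
    have hzero : ∀ m (f : MvPolynomial ℕ ℤ), f.IsHomogeneous m → m ≠ 0 →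
        constantCoeff f = 0 := by
      intro m f hf hm
      rw [constantCoeff_eq]
      exact hf.coeff_eq_zero (by simpa using hm.symm)
    refine ⟨(constantCoeff (R := ℤ) (σ := ℕ)).toAddMonoidHom, ?_, ?_, ?_⟩
    · intro x hx
      split_ifs with h
      · rw [h, schubert_one]
        simp
      · exact hzero _ _ (schubert_isHomogeneous hx) fun h0 => h (eq_one_of_invLen_eq_zero hx h0)
    · intro m f hf hm
      exact hzero m f hf (by rwa [invLen_one] at hm)
    · intro u a b _ _ _ h
      omega
  | succ l ih =>
    obtain ⟨k, hk⟩ : ∃ k, w (k + 1) < w k := exists_descent fun h => by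
      rw [h, invLen_one] at hl
      omega
    have hlen := invLen_mul_swap_of_gt hw hk
    obtain ⟨φ, h1, h2, h3⟩ := ih (hw.mul_swap k (k + 1)) (by omega)
    refine ⟨φ.comp (AddMonoidHom.mk' (divDiff k) (divDiff_add k)), ?_, ?_, ?_⟩
    · intro x hx
      change φ (divDiff k (Schubert x)) = _
      rcases apply_lt_or_gt x k with h | h
      · rw [divDiff_schubert_of_lt hx h, map_zero, if_neg]
        rintro rfl
        omega
      · rw [divDiff_schubert_of_gt hx h, h1 _ (hx.mul_swap _ _)]
        simp
    · intro m f hf hm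
      change φ (divDiff k f) = 0
      cases m with
      | zero => rw [divDiff_of_isHomogeneous_zero k hf, map_zero]
      | succ m => exact h2 m _ (divDiff_isHomogeneous hf) (by omega)
    · rintro u a b hu hab rfl hcov f hf
      change φ (divDiff k (f * Schubert u)) = _
      rw [divDiff_mul, map_add, divDiff_linear k hf, C_mul', map_zsmul, h1 u hu]
      by_cases hne : a = k ∧ b = k + 1
      · obtain ⟨rfl, rfl⟩ := hne
        have hlt := apply_lt_of_cover hu hab hcov
        rw [divDiff_schubert_of_lt hu hlt, if_pos (mul_swap_mul_swap u _ _).symm]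
        simp
      · have hgt := gt_of_cover_of_gt hu hab hcov hk hne
        have hconj : u * swap a b * swap k (k + 1) =
            u * swap k (k + 1) * swap (swap k (k + 1) a) (swap k (k + 1) b) := by
          rw [mul_assoc, mul_assoc, swap_apply_apply]
          simp [← mul_assoc]
        have hulen := invLen_mul_swap_of_gt hu hgt
        rw [divDiff_schubert_of_gt hu hgt, if_neg, h3 (u * swap k (k + 1)) (swap k (k + 1) a)
          (swap k (k + 1) b) (hu.mul_swap _ _) _ hconj (by omega) _ (simpleSwap_isHomogeneous k hf),
          smul_zero, add_zero, simpleSwap]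
        · have hcoeff : ∀ c, coeff (Finsupp.single (swap k (k + 1) c) 1)
              (rename (swap k (k + 1)) f) = coeff (Finsupp.single c 1) f := fun c => by
            rw [← coeff_rename_mapDomain (swap k (k + 1)) (Equiv.injective _) f,
              Finsupp.mapDomain_single]
          rw [hcoeff, hcoeff]
        · simp only [swap_apply_def]
          grind
        · intro e
          rw [mul_assoc, left_eq_mul, mul_eq_one_iff_eq_inv, swap_inv] at e
          have ea := congrArg (fun σ : Perm ℕ => σ a) e
          have eb := congrArg (fun σ : Perm ℕ => σ b) e
          simp only [swap_apply_left, swap_apply_right, swap_apply_def] at ea eb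
          grind

lemma IsSchubertCoeff.apply_eq {u v w : Perm ℕ} {c : Perm ℕ →₀ ℕ} (hc : IsSchubertCoeff u v c)
    {φ : MvPolynomial ℕ ℤ →+ ℤ}
    (hφ : ∀ x, IsFinPerm x → φ (Schubert x) = if x = w then 1 else 0) :
    (c w : ℤ) = φ (Schubert u * Schubert v) := by
  rw [hc.2, Finsupp.sum, map_sum]
  have h : ∀ x ∈ c.support, φ ((c x : MvPolynomial ℕ ℤ) * Schubert x) =
      if x = w then (c w : ℤ) else 0 := by
    intro x hx
    rw [← nsmul_eq_mul, map_nsmul, hφ x (hc.1 x hx)]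
    split_ifs with hxw
    · rw [hxw]; simp
    · simp
  rw [Finset.sum_congr rfl h, Finset.sum_ite_eq']
  split_ifs with hw'
  · rfl
  · simpa using hw'

lemma IsSchubertCoeff.eq_zero_of_invLen_ne {u v w : Perm ℕ} {c : Perm ℕ →₀ ℕ}
    (hc : IsSchubertCoeff u v c) (hu : IsFinPerm u) (hv : IsFinPerm v) (hw : IsFinPerm w)
    (h : invLen u + invLen v ≠ invLen w) : c w = 0 := by
  obtain ⟨φ, h1, h2, -⟩ := exists_dual hw
  have := hc.apply_eq h1
  rw [h2 _ _ ((schubert_isHomogeneous hu).mul (schubert_isHomogeneous hv)) h] at this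
  exact_mod_cast this

lemma isFinPerm_swap (a b : ℕ) : IsFinPerm (swap a b) := by
  simpa using isFinPerm_one.mul_swap a b

lemma invLen_simple (i : ℕ) : invLen (swap i (i + 1)) = 1 := by
  simpa [invLen_one] using invLen_mul_swap_of_lt (k := i) isFinPerm_one (by simp)

lemma schubert_simple_isHomogeneous (i : ℕ) :
    (Schubert (swap i (i + 1))).IsHomogeneous 1 := by
  have := schubert_isHomogeneous (isFinPerm_swap i (i + 1))
  rwa [invLen_simple] at this

lemma coeff_schubert_simple_sub (i k : ℕ) :
    coeff (Finsupp.single k 1) (Schubert (swap i (i + 1))) -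
      coeff (Finsupp.single (k + 1) 1) (Schubert (swap i (i + 1))) = if k = i then 1 else 0 := by
  have h := divDiff_linear k (schubert_simple_isHomogeneous i)
  apply C_injective ℕ ℤ
  rw [← h]
  split_ifs with hk
  · rw [hk, divDiff_schubert_of_gt (isFinPerm_swap _ _) (by simp), swap_mul_self, schubert_one, C_1]
  · rw [divDiff_schubert_of_lt (isFinPerm_swap _ _), C_0]
    simp only [swap_apply_def]
    grind

lemma coeff_schubert_simple_sub_of_lt {i j : ℕ} (h : i < j) :
    coeff (Finsupp.single i 1) (Schubert (swap i (i + 1))) -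
      coeff (Finsupp.single j 1) (Schubert (swap i (i + 1))) = 1 := by
  induction j, h using Nat.le_induction with
  | base => rw [coeff_schubert_simple_sub, if_pos rfl]
  | succ j hij ih =>
    have := coeff_schubert_simple_sub i j
    rw [if_neg (by omega)] at this
    omega

/-- the coefficient of a Bruhat cover `u ⋖ u·t_{ij}` in `𝔖_u·𝔖_{sᵢ}` (an instance of Monk's rule). -/
lemma IsSchubertCoeff.apply_cover {u : Perm ℕ} (hu : IsFinPerm u) {i j : ℕ} (hij : i < j)
    (hcov : invLen (u * swap i j) = invLen u + 1) {c : Perm ℕ →₀ ℕ}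
    (hc : IsSchubertCoeff u (swap i (i + 1)) c) : c (u * swap i j) = 1 := by
  obtain ⟨φ, h1, -, h3⟩ := exists_dual (hu.mul_swap i j)
  have := hc.apply_eq h1
  rw [mul_comm, h3 u i j hu hij rfl hcov _ (schubert_simple_isHomogeneous i),
    coeff_schubert_simple_sub_of_lt hij] at this
  exact_mod_cast this

end Coefficients

section BitScaling

open Equiv

/-- the inversions of `w` whose second position is larger than `d`; they correspond to the boxes in
the shaded columns of the Rothe diagram. -/
def shadedInversions (d : ℕ) (w : Perm ℕ) : Set (ℕ × ℕ) := {p | p ∈ inversions w ∧ d < p.2}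

lemma IsFinPerm.finite_shadedInversions {w : Perm ℕ} (hw : IsFinPerm w) (d : ℕ) :
    (shadedInversions d w).Finite :=
  hw.finite_inversions.subset fun _ h => h.1

lemma rothe_eq_image (w : Perm ℕ) : rothe w = (fun p => (p.1, w p.2)) '' inversions w := by
  ext ⟨r, h⟩
  simp only [rothe, inversions, Set.mem_ofPred_eq, Set.mem_image, Prod.exists, Prod.mk.injEq]
  constructor
  · rintro ⟨h1, h2⟩
    exact ⟨r, w.symm h, ⟨h2, by simpa using h1⟩, rfl, by simp⟩
  · rintro ⟨p, q, ⟨h1, h2⟩, rfl, rfl⟩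
    exact ⟨h2, by simpa using h1⟩

lemma ncard_rothe (w : Perm ℕ) : (rothe w).ncard = invLen w := by
  rw [rothe_eq_image, Set.ncard_image_of_injective]
  · rfl
  · rintro ⟨p, q⟩ ⟨p', q'⟩ h
    simp only [Prod.mk.injEq, w.injective.eq_iff] at h
    rw [h.1, h.2]

lemma mem_shadedCols {d q : ℕ} {w : Perm ℕ} : w q ∈ shadedCols d w ↔ d < q := by
  simp [shadedCols]

lemma stretchCol_eq_sum (d N : ℕ) (w : Perm ℕ) (j : ℕ) :
    stretchCol d N w j = ∑ h ∈ Finset.range j, if h ∈ shadedCols d w then N else 1 := by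
  have h1 : {h | h < j ∧ h ∉ shadedCols d w} =
      ↑((Finset.range j).filter fun h => h ∉ shadedCols d w) := by ext; simp
  have h2 : {h | h < j ∧ h ∈ shadedCols d w} =
      ↑((Finset.range j).filter fun h => h ∈ shadedCols d w) := by ext; simp
  rw [stretchCol, h1, h2, Set.ncard_coe_finset, Set.ncard_coe_finset, Finset.sum_ite,
    Finset.sum_const, Finset.sum_const, smul_eq_mul, smul_eq_mul]
  ring

/-- distinct columns are replaced by disjoint blocks of columns. -/
lemma stretchCol_add_lt {d N : ℕ} {w : Perm ℕ} {j j' m : ℕ} (hj : j < j')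
    (hm : m < if j ∈ shadedCols d w then N else 1) :
    stretchCol d N w j + m < stretchCol d N w j' := by
  have h : stretchCol d N w (j + 1) ≤ stretchCol d N w j' := by
    rw [stretchCol_eq_sum, stretchCol_eq_sum]
    exact Finset.sum_le_sum_of_subset (Finset.range_subset_range.2 hj)
  rw [stretchCol_eq_sum, Finset.sum_range_succ, ← stretchCol_eq_sum] at h
  omega

lemma IsBitScale.invLen_eq {d N : ℕ} (hN : 1 ≤ N) {w w' : Perm ℕ} (hw : IsFinPerm w)
    (h : IsBitScale d N w w') :
    invLen w' = invLen w + (N - 1) * (shadedInversions d w).ncard := by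
  set I := hw.finite_inversions.toFinset with hI
  have hcard : invLen w = I.card := Set.ncard_eq_toFinset_card _ hw.finite_inversions
  have hshaded : (shadedInversions d w).ncard = (I.filter fun p => d < p.2).card := by
    rw [← Set.ncard_coe_finset]
    congr 1
    ext p
    simp [hI, shadedInversions]
  have himage : rothe w' =
      (fun x : (_ : ℕ × ℕ) × ℕ => (x.1.1, stretchCol d N w (w x.1.2) + x.2)) ''
        ↑(I.sigma fun p => Finset.range (if d < p.2 then N else 1)) := by
    rw [h.2, rothe_eq_image]
    ext q
    simp only [Set.mem_ofPred_eq, Set.mem_image, exists_exists_and_eq_and, Finset.coe_sigma,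
      Set.mem_sigma_iff, Finset.mem_coe, Finset.mem_range, hI, Set.Finite.mem_toFinset,
      mem_shadedCols, Sigma.exists]
    constructor
    · rintro ⟨p, hp, m, hm, rfl⟩
      exact ⟨p, m, ⟨hp, hm⟩, rfl⟩
    · rintro ⟨p, m, ⟨hp, hm⟩, rfl⟩
      exact ⟨p, hp, m, hm, rfl⟩
  have hinj : Set.InjOn
      (fun x : (_ : ℕ × ℕ) × ℕ => (x.1.1, stretchCol d N w (w x.1.2) + x.2))
        ↑(I.sigma fun p => Finset.range (if d < p.2 then N else 1)) := by
    rintro ⟨⟨r, a⟩, m⟩ hx ⟨⟨r', a'⟩, m'⟩ hy hxy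
    simp only [Finset.coe_sigma, Set.mem_sigma_iff, Finset.mem_coe, Finset.mem_range] at hx hy
    have hm := hx.2
    have hm' := hy.2
    simp only [Prod.mk.injEq] at hxy
    obtain ⟨rfl, e⟩ := hxy
    rcases lt_trichotomy (w a) (w a') with hlt | heq | hlt
    · have :=
        stretchCol_add_lt (d := d) (N := N) (w := w) (m := m) hlt
          (by simpa only [mem_shadedCols] using hm)
      omega
    · obtain rfl := w.injective heq
      obtain rfl : m = m' := by omega
      rfl
    · have :=
        stretchCol_add_lt (d := d) (N := N) (w := w) (m := m') hlt
          (by simpa only [mem_shadedCols] using hm')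
      omega
  have hwidth : ∀ p : ℕ × ℕ, (if d < p.2 then N else 1) = 1 + if d < p.2 then N - 1 else 0 := by
    intro p
    split_ifs <;> omega
  rw [← ncard_rothe, himage, hinj.ncard_image, Set.ncard_coe_finset,
    Finset.card_sigma, hcard, hshaded]
  simp only [Finset.card_range, hwidth, Finset.sum_add_distrib, ← Finset.sum_filter,
    Finset.sum_const, smul_eq_mul, mul_one]
  ring

lemma shadedInversions_simple {d i : ℕ} (hid : i < d) :
    shadedInversions d (swap i (i + 1)) = ∅ := by
  ext ⟨p, q⟩
  simp only [shadedInversions, inversions, Set.mem_ofPred_eq, Set.mem_empty_iff_false, iff_false,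
    swap_apply_def]
  grind

/-- a Bruhat cover across the last descent strictly increases the number of shaded boxes. -/
lemma ncard_shadedInversions_lt {u : Perm ℕ} (hu : IsFinPerm u) {d i j : ℕ}
    (hd : ∀ e ∈ des u, e ≤ d) (hid : i ≤ d) (hdj : d < j) (hij : u i < u j) :
    (shadedInversions d u).ncard < (shadedInversions d (u * swap i j)).ncard := by
  have hincr : ∀ p q, d < p → p < q → u p < u q := by
    intro p q hp hpq
    have step : ∀ e, d < e → u e < u (e + 1) := fun e he =>
      (apply_lt_or_gt u e).resolve_right fun h => by have := hd e h; omega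
    induction q, hpq using Nat.le_induction with
    | base => exact step p hp
    | succ q hpq ih => exact ih.trans (step q (by omega))
  apply Set.ncard_lt_ncard _ ((hu.mul_swap i j).finite_shadedInversions d)
  rw [Set.ssubset_iff_of_subset]
  · refine ⟨(i, j), ⟨⟨by dsimp only; omega, by simpa using hij⟩, hdj⟩, fun h => ?_⟩
    exact absurd h.1.2 (by dsimp only; omega)
  · rintro ⟨p, q⟩ ⟨⟨hpq, hinv⟩, hq⟩
    dsimp only at hpq hinv hq
    have hp : p ≤ d := by
      by_contra hp
      have := hincr p q (by omega) hpq
      omega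
    refine ⟨⟨hpq, ?_⟩, hq⟩
    simp only [Perm.mul_apply, swap_apply_def]
    grind

end BitScaling

/-- Theorem 4.1: failure of the saturation property for Schubert coefficients under
bit scaling (with respect to `k = d`, the maximal descent of `u`). -/
theorem saturation_fails_bit_scaling
    (n : ℕ) (u : Equiv.Perm ℕ) (hu : InSymm n u)
    (d : ℕ) (hd : d ∈ des u) (hdmax : ∀ e ∈ des u, e ≤ d)
    (i j : ℕ) (hid : i < d) (hdj : d < j) (hjn : j < n)
    (hcov : invLen (u * Equiv.swap i j) = invLen u + 1) :
    (∀ c : Equiv.Perm ℕ →₀ ℕ, IsSchubertCoeff u (Equiv.swap i (i + 1)) c →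
      c (u * Equiv.swap i j) = 1) ∧
    (∀ N : ℕ, 1 < N → ∀ u' v' w' : Equiv.Perm ℕ,
      IsBitScale d N u u' → IsBitScale d N (Equiv.swap i (i + 1)) v' →
      IsBitScale d N (u * Equiv.swap i j) w' →
      ∀ c : Equiv.Perm ℕ →₀ ℕ, IsSchubertCoeff u' v' c → c w' = 0) := by
  have fu : IsFinPerm u := ⟨n, hu⟩
  have hij : i < j := hid.trans hdj
  refine ⟨fun c hc => hc.apply_cover fu hij hcov, fun N hN u' v' w' hu' hv' hw' c hc => ?_⟩
  apply hc.eq_zero_of_invLen_ne hu'.1 hv'.1 hw'.1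
  have hlt := ncard_shadedInversions_lt fu hdmax hid.le hdj (apply_lt_of_cover fu hij hcov)
  rw [hu'.invLen_eq hN.le fu, hv'.invLen_eq hN.le (isFinPerm_swap _ _),
    hw'.invLen_eq hN.le (fu.mul_swap i j), invLen_simple, shadedInversions_simple hid, hcov,
    Set.ncard_empty, mul_zero, add_zero]
  have := Nat.mul_lt_mul_of_pos_left hlt (Nat.sub_pos_of_lt hN)
  omega
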